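/- arXiv:quant-ph/0004017 — 3 statements merged into one kernel-verified Lean document; each statement's English description precedes it below -/
import Mathlib

section
/- (Intermediate bound in the proof of Lemma 8.) In the sealing setup, with a := ‖w_{0,0} − w_{0,1}‖, b := ‖w_{0,0} − w_{1,1}‖, c := ‖w_{0,1} − w_{1,0}‖, d := ‖w_{1,0} − w_{1,1}‖, the sum Δ := a + b + c + d satisfies Δ ≤ 132·√p·cot(2θ). -/
open Matrix
open scoped ComplexOrder

/-- `φ_α = (cos α, sin α) ∈ ℂ²`. -/
noncomputable def phiv (α : ℝ) : Fin 2 → ℂ := ![(Real.cos α : ℂ), (Real.sin α : ℂ)]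

/-- The angles of the four states of the bit escrow protocol. -/
noncomputable def ang (θ : ℝ) : Bool → Bool → ℝ
  | false, false => -θ
  | false, true  => θ
  | true,  false => Real.pi / 2 - θ
  | true,  true  => Real.pi / 2 + θ

/-- The four states `φ_{b,x}` of the bit escrow protocol. -/
noncomputable def phiBX (θ : ℝ) (b x : Bool) : Fin 2 → ℂ := phiv (ang θ b x)

variable {ι : Type*} [Fintype ι] [DecidableEq ι]

/-- The tensor product `φ_{b,x} ⊗ χ ∈ ℂ² ⊗ H ≅ H ⊕ H`, indexed by `Fin 2 × ι`. -/
noncomputable def inpV (θ : ℝ) (χ : ι → ℂ) (b x : Bool) : Fin 2 × ι → ℂ :=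
  fun ki => phiBX θ b x ki.1 * χ ki.2

/-- `u_{b,x}`: first component of `U (φ_{b,x} ⊗ χ₀) ∈ H ⊕ H`. -/
noncomputable def uV (θ : ℝ) (χ : ι → ℂ) (U : Matrix (Fin 2 × ι) (Fin 2 × ι) ℂ)
    (b x : Bool) : ι → ℂ :=
  fun i => (U *ᵥ inpV θ χ b x) (0, i)

/-- `v_{b,x}`: second component of `U (φ_{b,x} ⊗ χ₀) ∈ H ⊕ H`. -/
noncomputable def vV (θ : ℝ) (χ : ι → ℂ) (U : Matrix (Fin 2 × ι) (Fin 2 × ι) ℂ)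
    (b x : Bool) : ι → ℂ :=
  fun i => (U *ᵥ inpV θ χ b x) (1, i)

/-- The honest component `w_{b,x} = (φ_{b,x})₁ • u_{b,x} + (φ_{b,x})₂ • v_{b,x}`. -/
noncomputable def wV (θ : ℝ) (χ : ι → ℂ) (U : Matrix (Fin 2 × ι) (Fin 2 × ι) ℂ)
    (b x : Bool) : ι → ℂ :=
  phiBX θ b x 0 • uV θ χ U b x + phiBX θ b x 1 • vV θ χ U b x

/-- The cheating component `w'_{b,x} = (φ_{1−b,x})₁ • u_{b,x} + (φ_{1−b,x})₂ • v_{b,x}`. -/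
noncomputable def wpV (θ : ℝ) (χ : ι → ℂ) (U : Matrix (Fin 2 × ι) (Fin 2 × ι) ℂ)
    (b x : Bool) : ι → ℂ :=
  phiBX θ (!b) x 0 • uV θ χ U b x + phiBX θ (!b) x 1 • vV θ χ U b x

/-- Bob's detection probability `p = (1/4) Σ_{b,x} ‖w'_{b,x}‖²`. -/
noncomputable def pdet (θ : ℝ) (χ : ι → ℂ) (U : Matrix (Fin 2 × ι) (Fin 2 × ι) ℂ) : ℝ :=
  (1 / 4) * ∑ b : Bool, ∑ x : Bool, (star (wpV θ χ U b x) ⬝ᵥ wpV θ χ U b x).re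

/-- The norm `‖x‖ = √⟨x,x⟩` of a vector in `ℂ^ι`. -/
noncomputable def cnorm (x : ι → ℂ) : ℝ := Real.sqrt ((star x ⬝ᵥ x).re)

/-- `cnorm` is the Euclidean norm. -/
lemma cnorm_eq_norm_toLp (x : ι → ℂ) : cnorm x = ‖WithLp.toLp 2 x‖ := by
  rw [cnorm, norm_eq_sqrt_re_inner (𝕜 := ℂ), EuclideanSpace.inner_toLp_toLp,
    dotProduct_comm]
  rfl

lemma cnorm_nonneg (x : ι → ℂ) : 0 ≤ cnorm x := Real.sqrt_nonneg _

lemma cnorm_add_le (x y : ι → ℂ) : cnorm (x + y) ≤ cnorm x + cnorm y := by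
  simpa only [cnorm_eq_norm_toLp, WithLp.toLp_add] using norm_add_le _ _

lemma cnorm_sub_le (x y : ι → ℂ) : cnorm (x - y) ≤ cnorm x + cnorm y := by
  simpa only [cnorm_eq_norm_toLp, WithLp.toLp_sub] using norm_sub_le _ _

lemma cnorm_smul (r : ℝ) (x : ι → ℂ) : cnorm ((r : ℂ) • x) = |r| * cnorm x := by
  simp only [cnorm_eq_norm_toLp, WithLp.toLp_smul, norm_smul, Complex.norm_real, Real.norm_eq_abs]

lemma cnorm_sq (x : ι → ℂ) : cnorm x ^ 2 = (star x ⬝ᵥ x).re := by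
  apply Real.sq_sqrt
  rw [dotProduct, Complex.re_sum]
  refine Finset.sum_nonneg fun i _ => ?_
  simp only [Pi.star_apply, RCLike.star_def, Complex.mul_re, Complex.conj_re, Complex.conj_im]
  nlinarith [mul_self_nonneg (x i).re, mul_self_nonneg (x i).im]

/-- The sum of the norms of the cheating components is at most `4 √p`. -/
lemma sum_cnorm_wpV_le (θ : ℝ) (χ : ι → ℂ) (U : Matrix (Fin 2 × ι) (Fin 2 × ι) ℂ) :
    cnorm (wpV θ χ U false false) + cnorm (wpV θ χ U false true) +
      cnorm (wpV θ χ U true false) + cnorm (wpV θ χ U true true) ≤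
        4 * Real.sqrt (pdet θ χ U) := by
  set a := cnorm (wpV θ χ U false false) with ha
  set b := cnorm (wpV θ χ U false true) with hb
  set c := cnorm (wpV θ χ U true false) with hc
  set d := cnorm (wpV θ χ U true true) with hd
  have hp : pdet θ χ U = (1 / 4) * (a ^ 2 + b ^ 2 + c ^ 2 + d ^ 2) := by
    simp only [pdet, ← cnorm_sq, Fintype.sum_bool]
    ring
  have : (a + b + c + d) / 4 ≤ Real.sqrt (pdet θ χ U) := by
    apply Real.le_sqrt_of_sq_le
    rw [hp]
    nlinarith [sq_nonneg (a - b), sq_nonneg (a - c), sq_nonneg (a - d), sq_nonneg (b - c),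
      sq_nonneg (b - d), sq_nonneg (c - d)]
  linarith

/-- `U (φ_{b,x} ⊗ χ)` as a combination of the images of the two standard basis vectors. -/
lemma mulVec_inpV (θ : ℝ) (χ : ι → ℂ) (U : Matrix (Fin 2 × ι) (Fin 2 × ι) ℂ) (b x : Bool)
    (k : Fin 2 × ι) :
    (U *ᵥ inpV θ χ b x) k =
      phiBX θ b x 0 * ∑ j, U k (0, j) * χ j + phiBX θ b x 1 * ∑ j, U k (1, j) * χ j := by
  simp only [mulVec, dotProduct, inpV, Fintype.sum_prod_type, Fin.sum_univ_two, Finset.mul_sum]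
  congr 1 <;> exact Finset.sum_congr rfl fun j _ => by ring

section Identities

variable (θ : ℝ) (χ : ι → ℂ) (U : Matrix (Fin 2 × ι) (Fin 2 × ι) ℂ)

lemma wV_false_false_sub_false_true :
    ((Real.cos (2 * θ) : ℝ) : ℂ) • (wV θ χ U false false - wV θ χ U false true) =
      ((-(Real.sin (2 * θ) / 2) : ℝ) : ℂ) •
        (wpV θ χ U false false + wpV θ χ U false true + (wpV θ χ U true false + wpV θ χ U true true)) := by
  ext i
  simp only [wV, wpV, uV, vV, mulVec_inpV, phiBX, phiv, ang, Pi.add_apply, Pi.sub_apply,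
    Pi.smul_apply, smul_eq_mul, Real.sin_two_mul, Real.cos_two_mul', Real.cos_neg, Real.sin_neg,
    Real.cos_pi_div_two_sub, Real.sin_pi_div_two_sub, add_comm (Real.pi / 2),
    Real.cos_add_pi_div_two, Real.sin_add_pi_div_two, Matrix.cons_val_zero, Matrix.cons_val_one,
    Bool.not_false, Bool.not_true]
  push_cast
  ring

lemma wV_true_false_sub_true_true :
    ((Real.cos (2 * θ) : ℝ) : ℂ) • (wV θ χ U true false - wV θ χ U true true) =
      ((Real.sin (2 * θ) / 2 : ℝ) : ℂ) •
        (wpV θ χ U false false + wpV θ χ U false true + (wpV θ χ U true false + wpV θ χ U true true)) := by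
  ext i
  simp only [wV, wpV, uV, vV, mulVec_inpV, phiBX, phiv, ang, Pi.add_apply, Pi.sub_apply,
    Pi.smul_apply, smul_eq_mul, Real.sin_two_mul, Real.cos_two_mul', Real.cos_neg, Real.sin_neg,
    Real.cos_pi_div_two_sub, Real.sin_pi_div_two_sub, add_comm (Real.pi / 2),
    Real.cos_add_pi_div_two, Real.sin_add_pi_div_two, Matrix.cons_val_zero, Matrix.cons_val_one,
    Bool.not_false, Bool.not_true]
  push_cast
  ring

lemma wV_false_false_sub_true_true :
    ((Real.sin (2 * θ) : ℝ) : ℂ) • (wV θ χ U false false - wV θ χ U true true) =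
      ((Real.cos (2 * θ) / 2 : ℝ) : ℂ) •
        (wpV θ χ U false false - wpV θ χ U false true + (wpV θ χ U true false - wpV θ χ U true true)) := by
  ext i
  simp only [wV, wpV, uV, vV, mulVec_inpV, phiBX, phiv, ang, Pi.add_apply, Pi.sub_apply,
    Pi.smul_apply, smul_eq_mul, Real.sin_two_mul, Real.cos_two_mul', Real.cos_neg, Real.sin_neg,
    Real.cos_pi_div_two_sub, Real.sin_pi_div_two_sub, add_comm (Real.pi / 2),
    Real.cos_add_pi_div_two, Real.sin_add_pi_div_two, Matrix.cons_val_zero, Matrix.cons_val_one,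
    Bool.not_false, Bool.not_true]
  push_cast
  ring

lemma wV_false_true_sub_true_false :
    ((Real.sin (2 * θ) : ℝ) : ℂ) • (wV θ χ U false true - wV θ χ U true false) =
      ((Real.cos (2 * θ) / 2 : ℝ) : ℂ) •
        (wpV θ χ U false false - wpV θ χ U false true + (wpV θ χ U true false - wpV θ χ U true true)) := by
  ext i
  simp only [wV, wpV, uV, vV, mulVec_inpV, phiBX, phiv, ang, Pi.add_apply, Pi.sub_apply,
    Pi.smul_apply, smul_eq_mul, Real.sin_two_mul, Real.cos_two_mul', Real.cos_neg, Real.sin_neg,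
    Real.cos_pi_div_two_sub, Real.sin_pi_div_two_sub, add_comm (Real.pi / 2),
    Real.cos_add_pi_div_two, Real.sin_add_pi_div_two, Matrix.cons_val_zero, Matrix.cons_val_one,
    Bool.not_false, Bool.not_true]
  push_cast
  ring

end Identities

/-- Comparing norms in a proportionality relation. -/
lemma mul_cnorm_le_of_smul_eq {s r M : ℝ} (hs : 0 ≤ s) (hr : |r| ≤ M) {x y : ι → ℂ} {B : ℝ}
    (h : (s : ℂ) • x = (r : ℂ) • y) (hy : cnorm y ≤ B) : s * cnorm x ≤ M * B := by
  have h' := congrArg cnorm h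
  rw [cnorm_smul, cnorm_smul, abs_of_nonneg hs] at h'
  rw [h']
  exact mul_le_mul hr hy (cnorm_nonneg y) ((abs_nonneg r).trans hr)

/-- Intermediate bound in the proof of Lemma 8: with
`a = ‖w_{0,0} − w_{0,1}‖`, `b = ‖w_{0,0} − w_{1,1}‖`, `c = ‖w_{0,1} − w_{1,0}‖`,
`d = ‖w_{1,0} − w_{1,1}‖`, the sum `Δ = a + b + c + d` satisfies `Δ ≤ 132 √p cot(2θ)`. -/
theorem sealing_delta_bound (θ : ℝ) (hθ : 0 < θ) (hθ' : θ ≤ Real.pi / 8)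
    (χ : ι → ℂ) (hχ : star χ ⬝ᵥ χ = 1)
    (U : Matrix (Fin 2 × ι) (Fin 2 × ι) ℂ) (hU : U ∈ Matrix.unitaryGroup (Fin 2 × ι) ℂ) :
    cnorm (wV θ χ U false false - wV θ χ U false true) +
    cnorm (wV θ χ U false false - wV θ χ U true true) +
    cnorm (wV θ χ U false true - wV θ χ U true false) +
    cnorm (wV θ χ U true false - wV θ χ U true true) ≤
      132 * Real.sqrt (pdet θ χ U) * Real.cot (2 * θ) := by
  have hp := sum_cnorm_wpV_le θ χ U
  have hq := Real.sqrt_nonneg (pdet θ χ U)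
  set q := Real.sqrt (pdet θ χ U)
  have hsum : cnorm (wpV θ χ U false false + wpV θ χ U false true +
      (wpV θ χ U true false + wpV θ χ U true true)) ≤ 4 * q := by
    linarith [cnorm_add_le (wpV θ χ U false false + wpV θ χ U false true)
      (wpV θ χ U true false + wpV θ χ U true true),
      cnorm_add_le (wpV θ χ U false false) (wpV θ χ U false true),
      cnorm_add_le (wpV θ χ U true false) (wpV θ χ U true true)]
  have hdiff : cnorm (wpV θ χ U false false - wpV θ χ U false true +
      (wpV θ χ U true false - wpV θ χ U true true)) ≤ 4 * q := by
    linarith [cnorm_add_le (wpV θ χ U false false - wpV θ χ U false true)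
      (wpV θ χ U true false - wpV θ χ U true true),
      cnorm_sub_le (wpV θ χ U false false) (wpV θ χ U false true),
      cnorm_sub_le (wpV θ χ U true false) (wpV θ χ U true true)]
  have hs : 0 < Real.sin (2 * θ) := Real.sin_pos_of_pos_of_lt_pi (by linarith) (by linarith)
  have hsc : Real.sin (2 * θ) ≤ Real.cos (2 * θ) := by
    rw [← Real.cos_pi_div_two_sub]
    exact Real.cos_le_cos_of_nonneg_of_le_pi (by linarith) (by linarith) (by linarith)
  rw [Real.cot_eq_cos_div_sin]
  have e1 := wV_false_false_sub_false_true θ χ U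
  have e2 := wV_true_false_sub_true_true θ χ U
  have e3 := wV_false_false_sub_true_true θ χ U
  have e4 := wV_false_true_sub_true_false θ χ U
  set s := Real.sin (2 * θ)
  set c := Real.cos (2 * θ)
  have hc : 0 < c := hs.trans_le hsc
  have h1 := mul_cnorm_le_of_smul_eq hc.le
    (by rw [abs_neg, abs_of_pos (half_pos hs)] : |-(s / 2)| ≤ s / 2) e1 hsum
  have h2 := mul_cnorm_le_of_smul_eq hc.le (abs_of_pos (half_pos hs)).le e2 hsum
  have h3 := mul_cnorm_le_of_smul_eq hs.le (abs_of_pos (half_pos hc)).le e3 hdiff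
  have h4 := mul_cnorm_le_of_smul_eq hs.le (abs_of_pos (half_pos hc)).le e4 hdiff
  have key {z : ℝ} (h : s * z ≤ c / 2 * (4 * q)) : z ≤ 2 * q * (c / s) := by
    rw [← mul_div_assoc, le_div_iff₀ hs]
    linarith
  have key' {z : ℝ} (h : c * z ≤ s / 2 * (4 * q)) : z ≤ 2 * q * (c / s) := by
    have hz : z ≤ 2 * q := by
      have := mul_le_mul_of_nonneg_right hsc hq
      exact le_of_mul_le_mul_left (by linarith) hc
    exact hz.trans (le_mul_of_one_le_right (by linarith) ((one_le_div hs).mpr hsc))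
  have hcot : 0 ≤ q * (c / s) := by positivity
  linarith [key' h1, key' h2, key h3, key h4]
end

section
/- (Claim 12: reduced ancilla state under Bob's weak measurement.) Let (e_1,…,e_n) be an orthonormal basis of ℂⁿ, S ⊆ {1,…,n}, and M the orthogonal projection onto span{e_i : i ∉ S}. Fix p ∈ [0,1], let v := (√(1−p), √p) ∈ ℂ² and e_0 := (1,0) ∈ ℂ². Let U be any unitary on ℂⁿ ⊗ ℂ² such that U(e_i ⊗ e_0) = e_i ⊗ e_0 for i ∉ S and U(e_i ⊗ e_0) = e_i ⊗ v for i ∈ S. Then for every n×n density matrix ρ, the partial trace over ℂⁿ of U·(ρ ⊗ |e_0⟩⟨e_0|)·Uᴴ equals the 2×2 matrix Tr(ρM)·|e_0⟩⟨e_0| + (1 − Tr(ρM))·|v⟩⟨v|. -/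
open Matrix
open scoped ComplexOrder Kronecker

/-- The rank-one operator `|w⟩⟨w|`, i.e. the matrix with entries `w i * conj (w j)`. -/
noncomputable def outer {n : Type*} (w : n → ℂ) : Matrix n n ℂ :=
  Matrix.vecMulVec w (star w)

/-- The tensor product of vectors `x ∈ ℂⁿ` and `y ∈ ℂ²`, as a vector of `ℂⁿ ⊗ ℂ²`. -/
def tens {n : ℕ} (x : Fin n → ℂ) (y : Fin 2 → ℂ) : Fin n × Fin 2 → ℂ :=
  fun ik => x ik.1 * y ik.2

/-- The partial trace over `ℂⁿ` of a matrix on `ℂⁿ ⊗ ℂ²`: the `2×2` matrix with `(k,l)` entry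
`Σ_i A_{(i,k),(i,l)}`. -/
noncomputable def ptraceFst {n : ℕ} (A : Matrix (Fin n × Fin 2) (Fin n × Fin 2) ℂ) :
    Matrix (Fin 2) (Fin 2) ℂ :=
  Matrix.of fun k l => ∑ i : Fin n, A (i, k) (i, l)

theorem sum_outer_eq_one {n : ℕ} {e : Fin n → (Fin n → ℂ)}
    (he : ∀ i j, star (e i) ⬝ᵥ e j = if i = j then (1 : ℂ) else 0) :
    ∑ i, outer (e i) = 1 := by
  have h : (Matrix.of e)ᵀᴴ * (Matrix.of e)ᵀ = 1 := by
    ext i j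
    simpa [Matrix.mul_apply, dotProduct, Matrix.one_apply] using he i j
  rw [← mul_eq_one_comm.mp h]
  ext a b
  simp [Matrix.mul_apply, outer, Matrix.vecMulVec_apply, Matrix.sum_apply]

theorem trace_mul_outer {n : ℕ} (ρ : Matrix (Fin n) (Fin n) ℂ) (x : Fin n → ℂ) :
    (ρ * outer x).trace = star x ⬝ᵥ ρ *ᵥ x := by
  rw [outer, Matrix.mul_vecMulVec, Matrix.trace_vecMulVec, dotProduct_comm]

theorem eq_sum_smul_vecMulVec {n : ℕ} {e : Fin n → (Fin n → ℂ)}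
    (he : ∀ i j, star (e i) ⬝ᵥ e j = if i = j then (1 : ℂ) else 0)
    (ρ : Matrix (Fin n) (Fin n) ℂ) :
    ρ = ∑ i, ∑ j, (star (e i) ⬝ᵥ ρ *ᵥ e j) • vecMulVec (e i) (star (e j)) := by
  calc ρ = (∑ i, outer (e i)) * ρ * ∑ j, outer (e j) := by
        rw [sum_outer_eq_one he, one_mul, mul_one]
    _ = _ := by
        simp only [Finset.sum_mul, Finset.mul_sum]
        rw [Finset.sum_comm]
        refine Finset.sum_congr rfl fun i _ => Finset.sum_congr rfl fun j _ => ?_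
        rw [outer, outer, Matrix.vecMulVec_mul, Matrix.vecMulVec_mul_vecMulVec,
          ← Matrix.dotProduct_mulVec, Matrix.vecMulVec_smul]

theorem vecMulVec_kronecker_outer {n : ℕ} (x x' : Fin n → ℂ) (y : Fin 2 → ℂ) :
    vecMulVec x (star x') ⊗ₖ outer y = vecMulVec (tens x y) (star (tens x' y)) := by
  ext ⟨i, k⟩ ⟨j, l⟩
  simp [outer, tens, Matrix.vecMulVec_apply]
  ring

theorem mul_vecMulVec_star_mul_star {m : Type*} [Fintype m] (U : Matrix m m ℂ) (x y : m → ℂ) :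
    U * vecMulVec x (star y) * star U = vecMulVec (U *ᵥ x) (star (U *ᵥ y)) := by
  rw [Matrix.mul_vecMulVec, Matrix.vecMulVec_mul, Matrix.star_mulVec, Matrix.star_eq_conjTranspose]

theorem ptraceFst_sum {n : ℕ} {ι : Type*} (s : Finset ι)
    (A : ι → Matrix (Fin n × Fin 2) (Fin n × Fin 2) ℂ) :
    ptraceFst (∑ i ∈ s, A i) = ∑ i ∈ s, ptraceFst (A i) := by
  ext k l
  simp only [ptraceFst, Matrix.of_apply, Matrix.sum_apply]
  exact Finset.sum_comm

theorem ptraceFst_smul {n : ℕ} (c : ℂ) (A : Matrix (Fin n × Fin 2) (Fin n × Fin 2) ℂ) :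
    ptraceFst (c • A) = c • ptraceFst A := by
  ext k l
  simp [ptraceFst, Finset.mul_sum]

theorem ptraceFst_vecMulVec_tens {n : ℕ} (x x' : Fin n → ℂ) (y y' : Fin 2 → ℂ) :
    ptraceFst (vecMulVec (tens x y) (star (tens x' y'))) =
      (star x' ⬝ᵥ x) • vecMulVec y (star y') := by
  ext k l
  simp only [ptraceFst, tens, dotProduct, Matrix.of_apply, Matrix.vecMulVec_apply, Pi.star_apply,
    star_mul', Matrix.smul_apply, smul_eq_mul, Finset.sum_mul]
  exact Finset.sum_congr rfl fun i _ => by ring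

/-- If `U (e_i ⊗ y) = e_i ⊗ w_i` for an orthonormal basis `e`, then the reduced state of
`U (ρ ⊗ |y⟩⟨y|) Uᴴ` is the mixture of the `|w_i⟩⟨w_i|` with weights `Tr(ρ |e_i⟩⟨e_i|)`. -/
theorem ptraceFst_conj_kronecker_outer {n : ℕ} {e : Fin n → (Fin n → ℂ)}
    (he : ∀ i j, star (e i) ⬝ᵥ e j = if i = j then (1 : ℂ) else 0)
    {U : Matrix (Fin n × Fin 2) (Fin n × Fin 2) ℂ} {y : Fin 2 → ℂ} {w : Fin n → Fin 2 → ℂ}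
    (hU : ∀ i, U *ᵥ tens (e i) y = tens (e i) (w i)) (ρ : Matrix (Fin n) (Fin n) ℂ) :
    ptraceFst (U * (ρ ⊗ₖ outer y) * star U) =
      ∑ i, (ρ * outer (e i)).trace • outer (w i) := by
  have hρ : ρ ⊗ₖ outer y = ∑ i, ∑ j, (star (e i) ⬝ᵥ ρ *ᵥ e j) •
      vecMulVec (tens (e i) y) (star (tens (e j) y)) := by
    simp only [← vecMulVec_kronecker_outer]
    conv_lhs => rw [eq_sum_smul_vecMulVec he ρ]
    ext ⟨a, k⟩ ⟨b, l⟩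
    simp [Matrix.sum_apply, Finset.sum_mul, mul_assoc]
  simp only [hρ, Finset.mul_sum, Finset.sum_mul, Matrix.mul_smul, Matrix.smul_mul,
    mul_vecMulVec_star_mul_star, hU, ptraceFst_sum, ptraceFst_smul, ptraceFst_vecMulVec_tens, he,
    trace_mul_outer]
  simp [outer]

/-- Claim 12 (reduced ancilla state under Bob's weak measurement). If `(e_i)` is an orthonormal
basis of `ℂⁿ`, `M` the projection onto `span {e_i : i ∉ S}`, `v = (√(1−p), √p)`, `e₀ = (1,0)`,
and `U` is a unitary on `ℂⁿ ⊗ ℂ²` with `U (e_i ⊗ e₀) = e_i ⊗ e₀` for `i ∉ S` and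
`U (e_i ⊗ e₀) = e_i ⊗ v` for `i ∈ S`, then for every density matrix `ρ` the partial trace over
`ℂⁿ` of `U (ρ ⊗ |e₀⟩⟨e₀|) Uᴴ` equals `Tr(ρM)·|e₀⟩⟨e₀| + (1 − Tr(ρM))·|v⟩⟨v|`. -/
theorem reduced_ancilla_state {n : ℕ}
    (e : Fin n → (Fin n → ℂ))
    (he : ∀ i j, star (e i) ⬝ᵥ e j = if i = j then (1 : ℂ) else 0)
    (S : Finset (Fin n))
    (p : ℝ) (hp0 : 0 ≤ p) (hp1 : p ≤ 1)
    (U : Matrix (Fin n × Fin 2) (Fin n × Fin 2) ℂ)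
    (hU : U ∈ Matrix.unitaryGroup (Fin n × Fin 2) ℂ)
    (hUfix : ∀ i ∉ S, U *ᵥ tens (e i) (![1, 0]) = tens (e i) (![1, 0]))
    (hUrot : ∀ i ∈ S,
      U *ᵥ tens (e i) (![1, 0]) =
        tens (e i) (![(Real.sqrt (1 - p) : ℂ), (Real.sqrt p : ℂ)]))
    (ρ : Matrix (Fin n) (Fin n) ℂ) (hρ : ρ.PosSemidef) (hρtr : ρ.trace = 1) :
    ptraceFst (U * (ρ ⊗ₖ outer (![1, 0] : Fin 2 → ℂ)) * star U) =
      ((ρ * ∑ i ∈ Sᶜ, outer (e i)).trace) • outer (![1, 0] : Fin 2 → ℂ) +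
        (1 - (ρ * ∑ i ∈ Sᶜ, outer (e i)).trace) •
          outer (![(Real.sqrt (1 - p) : ℂ), (Real.sqrt p : ℂ)] : Fin 2 → ℂ) := by
  have hU' : ∀ i, U *ᵥ tens (e i) ![1, 0] = tens (e i)
      (if i ∈ S then ![(Real.sqrt (1 - p) : ℂ), (Real.sqrt p : ℂ)] else ![1, 0]) := by
    intro i
    split_ifs with hi
    · exact hUrot i hi
    · exact hUfix i hi
  have htr : 1 - (ρ * ∑ i ∈ Sᶜ, outer (e i)).trace = (ρ * ∑ i ∈ S, outer (e i)).trace := by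
    rw [sub_eq_iff_eq_add, ← Matrix.trace_add, ← mul_add, Finset.sum_add_sum_compl,
      sum_outer_eq_one he, mul_one, hρtr]
  rw [ptraceFst_conj_kronecker_outer he hU' ρ, htr, ← Finset.sum_compl_add_sum S]
  simp only [Finset.mul_sum, Matrix.trace_sum, Finset.sum_smul]
  congr 1
  · exact Finset.sum_congr rfl fun i hi => by rw [if_neg (Finset.mem_compl.mp hi)]
  · exact Finset.sum_congr rfl fun i hi => by rw [if_pos hi]
end

section
/- (Theorem 4, cheating Alice's bound.) Let x, p_0, q_0, p_err, q_err be real numbers in [0,1] satisfying: x ≤ (1 + |p_0 − q_0|)/2; (p_err + q_err)/2 ≤ 1 − x; and |p_0 − q_0| ≤ (√p_err + √q_err)/cos(π/4) = √2·(√p_err + √q_err). Then x ≤ (√8 − 1)/2 (≈ 0.9143). In particular, in the biased coin-flipping protocol with θ = π/8, no strategy of Alice wins with probability greater than (√8 − 1)/2. -/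
/-- Theorem 4, cheating Alice's bound. If `x, p₀, q₀, p_err, q_err ∈ [0,1]` satisfy
`x ≤ (1 + |p₀ − q₀|)/2`, `(p_err + q_err)/2 ≤ 1 − x`, and
`|p₀ − q₀| ≤ (√p_err + √q_err)/cos(π/4)`, then `x ≤ (√8 − 1)/2`. In particular, in the biased
coin-flipping protocol with `θ = π/8`, no strategy of Alice wins with probability greater than
`(√8 − 1)/2 ≈ 0.9143`. -/
theorem cheating_alice_bound (x p0 q0 perr qerr : ℝ)
    (hx : x ∈ Set.Icc (0 : ℝ) 1) (hp0 : p0 ∈ Set.Icc (0 : ℝ) 1)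
    (hq0 : q0 ∈ Set.Icc (0 : ℝ) 1) (hperr : perr ∈ Set.Icc (0 : ℝ) 1)
    (hqerr : qerr ∈ Set.Icc (0 : ℝ) 1)
    (h1 : x ≤ (1 + |p0 - q0|) / 2)
    (h2 : (perr + qerr) / 2 ≤ 1 - x)
    (h3 : |p0 - q0| ≤ (Real.sqrt perr + Real.sqrt qerr) / Real.cos (Real.pi / 4)) :
    x ≤ (Real.sqrt 8 - 1) / 2 := by
  have hs : √perr ^ 2 = perr := Real.sq_sqrt hperr.1
  have ht : √qerr ^ 2 = qerr := Real.sq_sqrt hqerr.1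
  have hbias : |p0 - q0| ^ 2 ≤ 8 * (1 - x) := by
    calc |p0 - q0| ^ 2 ≤ ((√perr + √qerr) / Real.cos (Real.pi / 4)) ^ 2 := by gcongr
      _ = 2 * (√perr + √qerr) ^ 2 := by
        rw [Real.cos_pi_div_four, div_pow, div_pow, Real.sq_sqrt zero_le_two]
        ring
      _ ≤ 8 * (1 - x) := by nlinarith [sq_nonneg (√perr - √qerr)]
  suffices 2 * x + 1 ≤ √8 by linarith
  apply Real.le_sqrt_of_sq_le
  rcases le_total (2 * x) 1 with hx_half | hx_half
  · nlinarith [hx.1]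
  · have : (2 * x - 1) ^ 2 ≤ |p0 - q0| ^ 2 :=
      pow_le_pow_left₀ (by linarith) (by linarith) 2
    nlinarith
end
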